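/- The 3x+1 conjecture holds if and only if for every positive integer n with binary representation n = x_k…x_0 = Σ_{i=0}^k x_i 2^i, the Turing machine M8 halts when started from the initial configuration ω0 (A 1) x_0 1 x_1 1 x_2 … 1 x_k 0ω (binary digits in order of increasing significance, each digit x_i coded by the pair 1 x_i). -/

import Mathlib

namespace Collatz

/-- The 3x+1 function. -/
def T (x : ℕ) : ℕ := if x % 2 = 0 then x / 2 else (3 * x + 1) / 2

/-- The 3x+1 conjecture: iterating `T` from any positive integer
eventually reaches the loop `2 ↦ 1 ↦ 2`. -/
def CollatzConjecture : Prop :=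
  ∀ x : ℕ, 0 < x → ∃ k : ℕ, T^[k] x = 2 ∧ T^[k + 1] x = 1

inductive St | A | B | C | D | E | F | G | H | I | J | K | L | M | Z
  deriving DecidableEq

/-- Symbols: `false` is the blank `0`, `true` is `1`. -/
abbrev Sym := Bool

open St

/-- Transition table of the Turing machine `M8`
(`true` = move right, `false` = move left); `Z` is the halting state,
`H` is an ordinary state, `delta I true` is undefined. -/
def delta : St → Sym → Option (Sym × Bool × St)
  | A, false => some (true, true, I)
  | A, true  => some (false, true, L)
  | B, false => some (false, true, A)
  | B, true  => some (false, true, G)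
  | C, false => some (false, true, A)
  | C, true  => some (true, true, D)
  | D, false => some (false, true, C)
  | D, true  => some (true, true, E)
  | E, false => some (true, true, I)
  | E, true  => some (true, true, F)
  | F, false => some (true, true, C)
  | F, true  => some (false, true, G)
  | G, false => some (true, true, C)
  | G, true  => some (true, true, H)
  | H, false => some (false, true, E)
  | H, true  => some (true, true, G)
  | I, false => some (true, false, J)
  | I, true  => none
  | J, false => some (false, true, B)
  | J, true  => some (true, false, K)
  | K, false => some (false, false, J)
  | K, true  => some (true, false, J)
  | L, false => some (false, true, A)
  | L, true  => some (false, true, M)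
  | M, false => some (false, false, Z)
  | M, true  => some (true, true, H)
  | Z, _     => none

structure Cfg where
  state : St
  head : ℤ
  tape : ℤ → Sym

/-- One step of the machine; `none` when the transition is undefined
(in particular in the halting state, which has no transitions).
In `delta`, the `Bool` component is the direction: `true` = right, `false` = left. -/
def step (c : Cfg) : Option Cfg :=
  (delta c.state (c.tape c.head)).map fun t =>
    ⟨t.2.2, c.head + (if t.2.1 then 1 else -1), Function.update c.tape c.head t.1⟩

/-- `steps n c` is the configuration after `n` steps from `c`
(`none` if the machine has halted meanwhile). -/
def steps : ℕ → Cfg → Option Cfg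
  | 0, c => some c
  | n + 1, c => (step c).bind (steps n)

/-- The tape holding the word `w` at positions `0, …, w.length - 1`,
and the blank symbol everywhere else. -/
def tapeOf (w : List Sym) : ℤ → Sym :=
  fun i => if 0 ≤ i then w.getD i.toNat false else false

/-- `c` is the configuration `ωb u (q s) v bω`, where `w = u ++ s :: v` and
`pos = u.length` (i.e. the tape holds exactly the word `w` surrounded by blanks,
the machine is in state `q`, and the head scans the symbol of `w` at index `pos`). -/
def IsConfig (c : Cfg) (q : St) (w : List Sym) (pos : ℕ) : Prop :=
  c.state = q ∧ ∃ d : ℤ, c.head = d + pos ∧ c.tape = fun i => tapeOf w (i - d)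

/-- The machine eventually reaches the configuration `ωb u (q s) v bω`. -/
def Reaches (c : Cfg) (q : St) (w : List Sym) (pos : ℕ) : Prop :=
  ∃ t : ℕ, ∃ c' : Cfg, steps t c = some c' ∧ IsConfig c' q w pos

/-- The machine halts when started from configuration `c`. -/
def Halts (c : Cfg) : Prop := ∃ n : ℕ, steps n c = none

/-- Initial configuration: word `w` on the tape, head on its leftmost symbol, state `A`. -/
def initCfg (w : List Sym) : Cfg := ⟨St.A, 0, tapeOf w⟩

/-- Encoding of a list of binary digits `[x_0, x_1, …, x_k]`
(least significant first) as the word `1 x_0 1 x_1 … 1 x_k`. -/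
def codeList : List ℕ → List Sym
  | [] => []
  | d :: ds => true :: decide (d = 1) :: codeList ds

/-- The word `1 x_0 1 x_1 … 1 x_k` where `x_k … x_0` is the binary
representation of `n`. -/
def codeWord (n : ℕ) : List Sym := codeList (Nat.digits 2 n)

/-- Configuration with head position `h`, left part `l` (nearest first), right part `r`. -/
def conf (q : St) (h : ℤ) (l r : List Bool) : Cfg :=
  ⟨q, h, fun i => if i < h then l.getD (h - 1 - i).toNat false else r.getD (i - h).toNat false⟩

theorem conf_head (q : St) (h : ℤ) (l r : List Bool) :
    (conf q h l r).tape (conf q h l r).head = r.headD false := by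
  cases r <;> simp [conf]

theorem step_right {q q' : St} {w : Bool} {l r : List Bool} (h : ℤ)
    (hd : delta q (r.headD false) = some (w, true, q')) :
    step (conf q h l r) = some (conf q' (h + 1) (w :: l) r.tail) := by
  unfold step
  rw [conf_head]
  change Option.map _ (delta q (r.headD false)) = _
  rw [hd]
  simp only [Option.map_some, conf, if_true, Option.some.injEq, Cfg.mk.injEq, true_and]
  funext i
  rcases lt_trichotomy i h with hi | hi | hi
  · obtain ⟨k, rfl⟩ : ∃ k : ℕ, i = h - 1 - k := ⟨(h - 1 - i).toNat, by omega⟩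
    have e1 : (h - 1 - (h - 1 - (k : ℤ))).toNat = k := by omega
    have e2 : (h + 1 - 1 - (h - 1 - (k : ℤ))).toNat = k + 1 := by omega
    have e3 : h - 1 - (k : ℤ) < h + 1 := by omega
    rw [Function.update_of_ne (by omega), if_pos hi, if_pos e3, e1, e2]
    simp
  · subst hi
    have e2 : (i + 1 - 1 - i).toNat = 0 := by omega
    simp
  · obtain ⟨k, rfl⟩ : ∃ k : ℕ, i = h + 1 + k := ⟨(i - h - 1).toNat, by omega⟩
    have e1 : (h + 1 + (k : ℤ) - h).toNat = k + 1 := by omega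
    have e2 : (h + 1 + (k : ℤ) - (h + 1)).toNat = k := by omega
    have e3 : ¬ (h + 1 + (k : ℤ) < h + 1) := by omega
    rw [Function.update_of_ne (by omega), if_neg (by omega), if_neg e3, e1, e2]
    cases r <;> simp

theorem step_left {q q' : St} {w : Bool} {l r : List Bool} (h : ℤ)
    (hd : delta q (r.headD false) = some (w, false, q')) :
    step (conf q h l r) = some (conf q' (h - 1) l.tail (l.headD false :: w :: r.tail)) := by
  unfold step
  rw [conf_head]
  change Option.map _ (delta q (r.headD false)) = _
  rw [hd]
  simp only [Option.map_some, conf, Option.some.injEq, Cfg.mk.injEq, true_and]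
  refine ⟨by simp; omega, ?_⟩
  funext i
  rcases lt_trichotomy i h with hi | hi | hi
  · obtain ⟨k, rfl⟩ : ∃ k : ℕ, i = h - 1 - k := ⟨(h - 1 - i).toNat, by omega⟩
    have e1 : (h - 1 - (h - 1 - (k : ℤ))).toNat = k := by omega
    rw [Function.update_of_ne (by omega), if_pos hi, e1]
    cases k with
    | zero => cases l <;> simp
    | succ k =>
      have e2 : (h - 1 - 1 - (h - 1 - ((k + 1 : ℕ) : ℤ))).toNat = k := by omega
      rw [if_pos (by omega), e2]
      cases l <;> simp
  · subst hi
    have e2 : (i - (i - 1)).toNat = 1 := by omega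
    simp
  · obtain ⟨k, rfl⟩ : ∃ k : ℕ, i = h + 1 + k := ⟨(i - h - 1).toNat, by omega⟩
    have e1 : (h + 1 + (k : ℤ) - h).toNat = k + 1 := by omega
    have e2 : (h + 1 + (k : ℤ) - (h - 1)).toNat = k + 2 := by omega
    rw [Function.update_of_ne (by omega), if_neg (by omega), if_neg (by omega), e1, e2]
    cases r <;> simp

theorem steps_add (a b : ℕ) (c : Cfg) : steps (a + b) c = (steps a c).bind (steps b) := by
  induction a generalizing c with
  | zero => simp [steps]
  | succ a ih =>
    rw [Nat.add_right_comm]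
    simp only [steps]
    cases step c with
    | none => rfl
    | some cc => simpa using ih cc

/-- Reachability in at least one step, ignoring the absolute head position. -/
def Go (q : St) (l r : List Bool) (q' : St) (l' r' : List Bool) : Prop :=
  ∀ h : ℤ, ∃ (n : ℕ) (h' : ℤ), steps (n + 1) (conf q h l r) = some (conf q' h' l' r')

theorem Go.trans {q l r q' l' r' q'' l'' r''} (h1 : Go q l r q' l' r')
    (h2 : Go q' l' r' q'' l'' r'') : Go q l r q'' l'' r'' := by
  intro h
  obtain ⟨n, h', e⟩ := h1 h
  obtain ⟨m, h'', e'⟩ := h2 h'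
  refine ⟨n + 1 + m, h'', ?_⟩
  rw [Nat.add_assoc, steps_add, e]
  exact e'

theorem Go.R {q : St} {l r : List Bool} (w : Bool) (q' : St)
    (hd : delta q (r.headD false) = some (w, true, q')) : Go q l r q' (w :: l) r.tail := by
  intro h
  exact ⟨0, h + 1, by simp [steps, step_right h hd]⟩

theorem Go.L {q : St} {l r : List Bool} (w : Bool) (q' : St)
    (hd : delta q (r.headD false) = some (w, false, q')) :
    Go q l r q' l.tail (l.headD false :: w :: r.tail) := by
  intro h
  exact ⟨0, h - 1, by simp [steps, step_left h hd]⟩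

theorem codeWord_zero : codeWord 0 = [] := by simp [codeWord, codeList]

theorem codeWord_pos {n : ℕ} (hn : 0 < n) :
    codeWord n = true :: decide (n % 2 = 1) :: codeWord (n / 2) := by
  unfold codeWord
  rw [Nat.digits_def' (by norm_num) hn]
  rfl

theorem codeWord_bit (m : ℕ) (b : Bool) (h : 0 < 2 * m + b.toNat) :
    codeWord (2 * m + b.toNat) = true :: b :: codeWord m := by
  rw [codeWord_pos h]
  have h2 : (2 * m + b.toNat) / 2 = m := by cases b <;> simp; omega
  rw [h2]
  cases b <;> simp

/-- Marker-reading state with carry `c`. -/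
def S : ℕ → St
  | 0 => St.C
  | 1 => St.E
  | _ => St.G

/-- Walking back over one pair. -/
theorem back (l r : List Bool) (d : Bool) :
    Go J (d :: true :: l) (true :: r) J l (true :: d :: true :: r) := by
  have h1 : Go J (d :: true :: l) (true :: r) K (true :: l) (d :: true :: r) := Go.L true K rfl
  have h2 : Go K (true :: l) (d :: true :: r) J l (true :: d :: true :: r) := by
    cases d
    · exact Go.L false J rfl
    · exact Go.L true J rfl
  exact h1.trans h2

theorem digit (c : ℕ) (hc : c ≤ 2) (d : Bool) (l r : List Bool) :
    ∃ (c' : ℕ) (d' : Bool), c' ≤ 2 ∧ 3 * d.toNat + c = 2 * c' + d'.toNat ∧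
      Go (S c) l (true :: d :: r) (S c') (d' :: true :: l) r := by
  interval_cases c <;> cases d
  · exact ⟨0, false, by decide, by decide, (Go.R true D rfl).trans (Go.R false C rfl)⟩
  · exact ⟨1, true, by decide, by decide, (Go.R true D rfl).trans (Go.R true E rfl)⟩
  · exact ⟨0, true, by decide, by decide, (Go.R true F rfl).trans (Go.R true C rfl)⟩
  · exact ⟨2, false, by decide, by decide, (Go.R true F rfl).trans (Go.R false G rfl)⟩
  · exact ⟨1, false, by decide, by decide, (Go.R true H rfl).trans (Go.R false E rfl)⟩
  · exact ⟨2, true, by decide, by decide, (Go.R true H rfl).trans (Go.R true G rfl)⟩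

theorem sweep (m : ℕ) : ∀ (c : ℕ), c ≤ 2 → 0 < m + c → ∀ l : List Bool,
    Go (S c) l (codeWord m) J l (codeWord (3 * m + c)) := by
  induction m using Nat.strong_induction_on with
  | _ m ih =>
    intro c hc hmc l
    rcases Nat.eq_zero_or_pos m with rfl | hm
    · have w1 : codeWord 1 = [true, true] := by simp [codeWord, codeList]
      have w2 : codeWord 2 = [true, false, true, true] := by simp [codeWord, codeList]
      rw [codeWord_zero]
      obtain rfl | rfl : c = 1 ∨ c = 2 := by omega
      · rw [Nat.mul_zero, Nat.zero_add, w1]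
        have h1 : Go E l [] I (true :: l) [] := Go.R true I rfl
        have h2 : Go I (true :: l) [] J l [true, true] := Go.L true J rfl
        exact h1.trans h2
      · rw [Nat.mul_zero, Nat.zero_add, w2]
        have h1 : Go G l [] C (true :: l) [] := Go.R true C rfl
        have h2 : Go C (true :: l) [] A (false :: true :: l) [] := Go.R false A rfl
        have h3 : Go A (false :: true :: l) [] I (true :: false :: true :: l) [] := Go.R true I rfl
        have h4 : Go I (true :: false :: true :: l) [] J (false :: true :: l) [true, true] :=
          Go.L true J rfl
        exact (((h1.trans h2).trans h3).trans h4).trans (back _ _ _)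
    · rw [codeWord_pos hm]
      obtain ⟨c', d', hc', he, hg⟩ := digit c hc (decide (m % 2 = 1)) l (codeWord (m / 2))
      have hb : (decide (m % 2 = 1)).toNat = m % 2 := by
        rcases Nat.mod_two_eq_zero_or_one m with h | h <;> simp [h]
      rw [hb] at he
      have hd' : d'.toNat ≤ 1 := Bool.toNat_le d'
      have hpos : 0 < m / 2 + c' := by omega
      have h2 := ih (m / 2) (by omega) c' hc' hpos (d' :: true :: l)
      have e : 3 * m + c = 2 * (3 * (m / 2) + c') + d'.toNat := by omega
      rw [e, codeWord_bit _ _ (by omega)]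
      rw [codeWord_pos (n := 3 * (m / 2) + c') (by omega)] at h2 ⊢
      exact (hg.trans h2).trans (back _ _ _)

theorem sweepM (m : ℕ) (hm : 0 < m) (l : List Bool) :
    Go M l (codeWord m) J l (codeWord (3 * m + 2)) := by
  intro h
  obtain ⟨n, h', e⟩ := sweep m 2 le_rfl (by omega) l h
  refine ⟨n, h', ?_⟩
  rw [← e, codeWord_pos hm]
  simp only [steps]
  rw [step_right (w := true) (q' := H) h rfl, step_right (w := true) (q' := H) h rfl]

theorem A_step (n : ℕ) (hn : 1 < n) (k : ℕ) :
    Go A (List.replicate k false) (codeWord n) A (List.replicate (k + 2) false)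
      (codeWord (T n)) := by
  rw [codeWord_pos (n := n) (by omega)]
  unfold T
  simp only [List.replicate_succ]
  rcases Nat.mod_two_eq_zero_or_one n with h | h
  · simp only [h, if_true]
    exact (Go.R false L rfl).trans (Go.R false A rfl)
  · simp only [h, decide_true]
    have e : (3 * n + 1) / 2 = 3 * (n / 2) + 2 := by omega
    rw [if_neg (by omega), e]
    generalize List.replicate k false = z
    have h1 : Go A z (true :: true :: codeWord (n / 2)) M (false :: false :: z) (codeWord (n / 2)) :=
      (Go.R false L rfl).trans (Go.R false M rfl)
    have h2 := sweepM (n / 2) (by omega) (false :: false :: z)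
    refine (h1.trans h2).trans ?_
    rw [codeWord_pos (n := 3 * (n / 2) + 2) (by omega)]
    generalize decide ((3 * (n / 2) + 2) % 2 = 1) :: codeWord ((3 * (n / 2) + 2) / 2) = r
    have h3 : Go J (false :: false :: z) (true :: r) K (false :: z) (false :: true :: r) :=
      Go.L true K rfl
    have h4 : Go K (false :: z) (false :: true :: r) J z (false :: false :: true :: r) :=
      Go.L false J rfl
    have h5 : Go J z (false :: false :: true :: r) B (false :: z) (false :: true :: r) :=
      Go.R false B rfl
    have h6 : Go B (false :: z) (false :: true :: r) A (false :: false :: z) (true :: r) :=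
      Go.R false A rfl
    exact ((h3.trans h4).trans h5).trans h6

theorem A_one (l : List Bool) (h : ℤ) : Halts (conf A h l (codeWord 1)) := by
  have w1 : codeWord 1 = [true, true] := by simp [codeWord, codeList]
  rw [w1]
  have g : Go A l [true, true] Z (false :: l) [false, false] :=
    ((Go.R false L rfl).trans (Go.R false M rfl)).trans (Go.L false Z rfl)
  obtain ⟨n, h', e⟩ := g h
  refine ⟨n + 1 + 1, ?_⟩
  rw [steps_add, e]
  rfl

theorem T_pos {n : ℕ} (hn : 0 < n) : 0 < T n := by
  unfold T; split_ifs <;> omega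

theorem halts_of_T (j : ℕ) : ∀ (n k : ℕ) (h : ℤ), 0 < n → T^[j] n = 1 →
    Halts (conf A h (List.replicate k false) (codeWord n)) := by
  induction j with
  | zero =>
    intro n k h _ e
    have e : n = 1 := e
    subst e
    exact A_one _ _
  | succ j ih =>
    intro n k h hn e
    by_cases h1 : n = 1
    · subst h1
      exact A_one _ _
    · obtain ⟨s, h', es⟩ := A_step n (by omega) k h
      obtain ⟨t, et⟩ := ih (T n) (k + 2) h' (T_pos hn) e
      exact ⟨s + 1 + t, by rw [steps_add, es]; exact et⟩

theorem T_of_halts (N : ℕ) : ∀ (n k : ℕ) (h : ℤ), 0 < n →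
    steps N (conf A h (List.replicate k false) (codeWord n)) = none → ∃ j, T^[j] n = 1 := by
  induction N using Nat.strong_induction_on with
  | _ N ih =>
    intro n k h hn e
    by_cases h1 : n = 1
    · exact ⟨0, h1⟩
    · obtain ⟨s, h', es⟩ := A_step n (by omega) k h
      rcases Nat.lt_or_ge N (s + 1) with hlt | hge
      · obtain ⟨d, hd⟩ := Nat.exists_eq_add_of_lt hlt
        rw [hd, Nat.add_assoc, steps_add, e] at es
        simp at es
      · obtain ⟨d, rfl⟩ := Nat.exists_eq_add_of_le hge
        rw [steps_add, es] at e
        obtain ⟨j, hj⟩ := ih d (by omega) (T n) (k + 2) h' (T_pos hn) e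
        exact ⟨j + 1, hj⟩

theorem initCfg_eq (w : List Bool) : initCfg w = conf A 0 (List.replicate 0 false) w := by
  unfold initCfg conf tapeOf
  congr 1
  funext i
  by_cases hi : 0 ≤ i
  · simp [hi]
  · simp [hi]

/-- The 3x+1 conjecture holds iff for every positive integer `n` with binary
representation `n = x_k … x_0`, the machine `M8` halts when started from
`ω0 (A 1) x_0 1 x_1 … 1 x_k 0ω`. -/
theorem collatz_iff_M8_halts :
    CollatzConjecture ↔
      ∀ n : ℕ, 0 < n → Halts (initCfg (codeWord n)) := by
  constructor
  · intro hC n hn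
    obtain ⟨k, _, hk⟩ := hC n hn
    rw [initCfg_eq]
    exact halts_of_T (k + 1) n 0 0 hn hk
  · intro hH n hn
    obtain ⟨N, hN⟩ := hH n hn
    rw [initCfg_eq] at hN
    obtain ⟨j, hj⟩ := T_of_halts N n 0 0 hn hN
    have h1 : T^[j + 1] n = 2 := by rw [Function.iterate_succ_apply', hj]; rfl
    refine ⟨j + 1, h1, ?_⟩
    rw [Function.iterate_succ_apply', h1]
    rfl

end Collatz
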